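/- (Global convergence of the average-type nonmonotone multiobjective memory gradient algorithm.) Let F : ℝⁿ → ℝᵐ be continuously differentiable with each ∇Fᵢ Lipschitz continuous with constant L > 0 and each Fᵢ bounded from below; let ψ(x,d) = max_{1≤i≤m} ⟨∇Fᵢ(x), d⟩ and v(x) the unique minimizer over d of ψ(x,d) + ½‖d‖². Let ρ, δ ∈ (0,1), 0 ≤ ηₖ ≤ η_max < 1, and let (xₖ), (dₖ), (αₖ), (Qₖ), (Cₖ) satisfy: Q₀ = 1, C₀ = F(x₀), Q_{k+1} = ηₖ Qₖ + 1, C_{k+1,i} = (ηₖ Qₖ C_{k,i} + Fᵢ(x_{k+1}))/Q_{k+1}; no xₖ is Pareto critical; there are constants c > 0 and ξ₁, ξ₂ > 0 with ψ(xₖ,dₖ) ≤ c·ψ(xₖ,v(xₖ)), ‖v(xₖ)‖ ≤ ξ₁ and ‖dₖ‖ ≤ ξ₂ for all k; αₖ = δ^{hₖ} τₖ with τₖ = −ψ(xₖ,dₖ)/‖dₖ‖² and hₖ the smallest nonnegative integer j such that Fᵢ(xₖ + τₖ δʲ dₖ) ≤ C_{k,i} + ρ τₖ δʲ ψ(xₖ,dₖ)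 for all i; and x_{k+1} = xₖ + αₖ dₖ. Then lim inf_{k→∞} ‖v(xₖ)‖ = 0. -/

import Mathlib

open scoped RealInnerProductSpace

noncomputable def psi {n m : ℕ} [NeZero m]
    (F : Fin m → EuclideanSpace ℝ (Fin n) → ℝ)
    (x d : EuclideanSpace ℝ (Fin n)) : ℝ :=
  Finset.univ.sup' Finset.univ_nonempty fun i => ⟪gradient (F i) x, d⟫

theorem LipschitzWith.le_add_inner_gradient_add {E : Type*} [NormedAddCommGroup E]
    [InnerProductSpace ℝ E] [CompleteSpace E] {f : E → ℝ} (hf : Differentiable ℝ f) {K : NNReal}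
    (hK : LipschitzWith K (fun y => gradient f y)) (x e : E) :
    f (x + e) ≤ f x + ⟪gradient f x, e⟫ + K * ‖e‖ ^ 2 := by
  have key := (convex_closedBall x ‖e‖).norm_image_sub_le_of_norm_hasFDerivWithin_le'
    (f := f) (f' := fun y => InnerProductSpace.toDual ℝ E (gradient f y))
    (φ := InnerProductSpace.toDual ℝ E (gradient f x)) (C := K * ‖e‖) (x := x) (y := x + e)
    (fun y _ => (hf y).hasGradientAt.hasFDerivAt.hasFDerivWithinAt)
    (fun y hy => by
      rw [← map_sub, LinearIsometryEquiv.norm_map, ← dist_eq_norm]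
      refine (hK.dist_le_mul y x).trans ?_
      gcongr
      exact hy)
    (by simp) (by simp)
  rw [add_sub_cancel_left, InnerProductSpace.toDual_apply_apply] at key
  have := (Real.le_norm_self _).trans key
  nlinarith

section psi

variable {n m : ℕ} [NeZero m] (F : Fin m → EuclideanSpace ℝ (Fin n) → ℝ)

theorem inner_gradient_le_psi (x d : EuclideanSpace ℝ (Fin n)) (i : Fin m) :
    ⟪gradient (F i) x, d⟫ ≤ psi F x d :=
  Finset.le_sup' (fun i => ⟪gradient (F i) x, d⟫) (Finset.mem_univ i)

theorem psi_zero (x : EuclideanSpace ℝ (Fin n)) : psi F x 0 = 0 := by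
  simp [psi]

theorem psi_smul_le (x d : EuclideanSpace ℝ (Fin n)) {t : ℝ} (ht : 0 ≤ t) :
    psi F x (t • d) ≤ t * psi F x d := by
  refine Finset.sup'_le _ _ fun i _ => ?_
  rw [inner_smul_right]
  exact mul_le_mul_of_nonneg_left (inner_gradient_le_psi F x d i) ht

theorem psi_neg_of_isMinimizer {x w : EuclideanSpace ℝ (Fin n)}
    (hw : ∀ d, psi F x w + ‖w‖ ^ 2 / 2 ≤ psi F x d + ‖d‖ ^ 2 / 2)
    (hx : ∃ d, psi F x d < 0) : psi F x w < 0 := by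
  obtain ⟨d, hd⟩ := hx
  have hpos : 0 < ‖d‖ ^ 2 + 1 := by positivity
  set t := -psi F x d / (‖d‖ ^ 2 + 1) with ht
  have ht0 : 0 < t := div_pos (neg_pos.2 hd) hpos
  have hmul : t * (‖d‖ ^ 2 + 1) = -psi F x d := div_mul_cancel₀ _ hpos.ne'
  have h1 := hw (t • d)
  have h2 := psi_smul_le F x d ht0.le
  rw [norm_smul, Real.norm_of_nonneg ht0.le] at h1
  have h3 : t * (t * (‖d‖ ^ 2 + 1)) = t * -psi F x d := by rw [hmul]
  nlinarith [sq_nonneg ‖w‖, mul_pos ht0 ht0, mul_pos ht0 (neg_pos.2 hd)]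

theorem psi_le_neg_half_sq_of_isMinimizer {x w : EuclideanSpace ℝ (Fin n)}
    (hw : ∀ d, psi F x w + ‖w‖ ^ 2 / 2 ≤ psi F x d + ‖d‖ ^ 2 / 2) :
    psi F x w ≤ -(‖w‖ ^ 2 / 2) := by
  have := hw 0
  rw [psi_zero, norm_zero] at this
  linarith

theorem le_add_mul_psi_of_step_le {K : NNReal} (hF : ∀ i, Differentiable ℝ (F i))
    (hLip : ∀ i, LipschitzWith K (fun y => gradient (F i) y))
    {x d : EuclideanSpace ℝ (Fin n)} {ρ t : ℝ} (ht : 0 ≤ t)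
    (hstep : K * (t * ‖d‖ ^ 2) ≤ (1 - ρ) * -psi F x d) (i : Fin m) :
    F i (x + t • d) ≤ F i x + ρ * t * psi F x d := by
  have h1 := (hLip i).le_add_inner_gradient_add (hF i) x (t • d)
  have h2 := mul_le_mul_of_nonneg_left (inner_gradient_le_psi F x d i) ht
  rw [inner_smul_right, norm_smul, Real.norm_of_nonneg ht] at h1
  have h3 := mul_le_mul_of_nonneg_left hstep ht
  nlinarith

end psi

theorem stmt16 {n m : ℕ} [NeZero m]
    (F : Fin m → EuclideanSpace ℝ (Fin n) → ℝ)
    (hF : ∀ i, ContDiff ℝ 1 (F i))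
    (L : ℝ) (hL : 0 < L)
    (hLip : ∀ i, LipschitzWith L.toNNReal (fun y => gradient (F i) y))
    (hbdd : ∀ i, BddBelow (Set.range (F i)))
    (v : EuclideanSpace ℝ (Fin n) → EuclideanSpace ℝ (Fin n))
    (hv : ∀ x d, psi F x (v x) + ‖v x‖ ^ 2 / 2 ≤ psi F x d + ‖d‖ ^ 2 / 2)
    (ρ δ : ℝ) (hρ : ρ ∈ Set.Ioo (0 : ℝ) 1) (hδ : δ ∈ Set.Ioo (0 : ℝ) 1)
    (η : ℕ → ℝ) (ηmax : ℝ) (hηmax : ηmax < 1)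
    (hη : ∀ k, 0 ≤ η k ∧ η k ≤ ηmax)
    (x d : ℕ → EuclideanSpace ℝ (Fin n)) (α Q : ℕ → ℝ) (C : ℕ → Fin m → ℝ)
    (hQ0 : Q 0 = 1) (hC0 : ∀ i, C 0 i = F i (x 0))
    (hQ : ∀ k, Q (k + 1) = η k * Q k + 1)
    (hC : ∀ k i, C (k + 1) i = (η k * Q k * C k i + F i (x (k + 1))) / Q (k + 1))
    (hncrit : ∀ k, ∃ dd, psi F (x k) dd < 0)
    (c ξ₁ ξ₂ : ℝ) (hc : 0 < c) (hξ₁ : 0 < ξ₁) (hξ₂ : 0 < ξ₂)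
    (hsd : ∀ k, psi F (x k) (d k) ≤ c * psi F (x k) (v (x k)))
    (hvb : ∀ k, ‖v (x k)‖ ≤ ξ₁) (hdb : ∀ k, ‖d k‖ ≤ ξ₂)
    (τ : ℕ → ℝ) (hτ : ∀ k, τ k = -psi F (x k) (d k) / ‖d k‖ ^ 2)
    (h : ℕ → ℕ)
    (hArm : ∀ k i, F i (x k + (δ ^ h k * τ k) • d k) ≤
      C k i + ρ * (δ ^ h k * τ k) * psi F (x k) (d k))
    (hmin : ∀ k, ∀ j < h k, ∃ i, F i (x k + (δ ^ j * τ k) • d k) >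
      C k i + ρ * (δ ^ j * τ k) * psi F (x k) (d k))
    (hα : ∀ k, α k = δ ^ h k * τ k)
    (hstep : ∀ k, x (k + 1) = x k + α k • d k) :
    Filter.liminf (fun k => ‖v (x k)‖) Filter.atTop = 0 := by
  obtain ⟨hρ0, hρ1⟩ := hρ
  obtain ⟨hδ0, hδ1⟩ := hδ
  have hdiff : ∀ i, Differentiable ℝ (F i) := fun i => (hF i).differentiable one_ne_zero
  have hK : (L.toNNReal : ℝ) = L := Real.coe_toNNReal L hL.le
  have hψneg : ∀ k, psi F (x k) (d k) < 0 := fun k =>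
    (hsd k).trans_lt (mul_neg_of_pos_of_neg hc
      (psi_neg_of_isMinimizer F (hv (x k)) (hncrit k)))
  have hψv : ∀ k, c * ‖v (x k)‖ ^ 2 / 2 ≤ -psi F (x k) (d k) := fun k => by
    have := mul_le_mul_of_nonneg_left
      (psi_le_neg_half_sq_of_isMinimizer F (hv (x k))) hc.le
    linarith [hsd k]
  have hdpos : ∀ k, 0 < ‖d k‖ ^ 2 := fun k => by
    have : d k ≠ 0 := fun h0 => by
      have := hψneg k
      rw [h0, psi_zero] at this
      exact this.false
    positivity
  have hτpos : ∀ k, 0 < τ k := fun k => by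
    rw [hτ]
    exact div_pos (neg_pos.2 (hψneg k)) (hdpos k)
  have hτd : ∀ k, τ k * ‖d k‖ ^ 2 = -psi F (x k) (d k) := fun k => by
    rw [hτ, div_mul_cancel₀ _ (hdpos k).ne']
  have hQ1 : ∀ k, 1 ≤ Q k := fun k => by
    induction k with
    | zero => exact hQ0.ge
    | succ k ih => rw [hQ]; nlinarith [(hη k).1]
  have hηmax0 : 0 ≤ ηmax := (hη 0).1.trans (hη 0).2
  have hQle : ∀ k, Q k * (1 - ηmax) ≤ 1 := fun k => by
    induction k with
    | zero => rw [hQ0]; linarith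
    | succ k ih =>
      have h1 : η k * Q k ≤ ηmax * Q k :=
        mul_le_mul_of_nonneg_right (hη k).2 (zero_le_one.trans (hQ1 k))
      rw [hQ]
      nlinarith [sub_pos.2 hηmax]
  have hFstep : ∀ k i, F i (x (k + 1)) ≤ C k i + ρ * α k * psi F (x k) (d k) :=
    fun k i => by rw [hstep, hα]; exact hArm k i
  have hαpos : ∀ k, 0 < α k := fun k => by
    rw [hα]
    exact mul_pos (pow_pos hδ0 _) (hτpos k)
  have hCQ : ∀ k i, C (k + 1) i * Q (k + 1) = η k * Q k * C k i + F i (x (k + 1)) :=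
    fun k i => by rw [hC, div_mul_cancel₀ _ (zero_lt_one.trans_le (hQ1 _)).ne']
  have hdec : ∀ k, 0 < ρ * α k * -psi F (x k) (d k) := fun k =>
    mul_pos (mul_pos hρ0 (hαpos k)) (neg_pos.2 (hψneg k))
  have hFC : ∀ k i, F i (x k) ≤ C k i := fun k i => by
    cases k with
    | zero => exact (hC0 i).ge
    | succ k =>
      have h0 : 0 ≤ η k * Q k := mul_nonneg (hη k).1 (zero_le_one.trans (hQ1 k))
      have h1 : F i (x (k + 1)) ≤ C k i := by linarith [hFstep k i, hdec k]
      have h2 := mul_le_mul_of_nonneg_left h1 h0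
      refine le_of_mul_le_mul_right ?_ (zero_lt_one.trans_le (hQ1 (k + 1)))
      rw [hCQ, hQ]
      linarith
  set β := min 1 (δ * ((1 - ρ) / L)) with hβ
  have hβ0 : 0 < β := lt_min one_pos (mul_pos hδ0 (div_pos (sub_pos.2 hρ1) hL))
  have hβle : ∀ k, β ≤ δ ^ h k := fun k => by
    rcases hk : h k with _ | j
    · exact (min_le_left _ _).trans (pow_zero δ).ge
    · refine (min_le_right _ _).trans ?_
      rw [pow_succ']
      refine mul_le_mul_of_nonneg_left ?_ hδ0.le
      by_contra! hlt
      obtain ⟨i, hi⟩ := hmin k j (by omega)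
      refine hi.not_ge ?_
      refine (le_add_mul_psi_of_step_le F hdiff hLip (ρ := ρ)
        (mul_pos (pow_pos hδ0 j) (hτpos k)).le ?_ i).trans
        (add_le_add_left (hFC k i) _)
      rw [hK, mul_assoc, hτd, ← mul_assoc]
      refine mul_le_mul_of_nonneg_right ?_ (neg_pos.2 (hψneg k)).le
      rw [lt_div_iff₀ hL] at hlt
      linarith
  have hbound : ∀ k, β * (c * ‖v (x k)‖ ^ 2 / 2) ^ 2 ≤
      ξ₂ ^ 2 * (α k * -psi F (x k) (d k)) := fun k => by
    have hψ := neg_pos.2 (hψneg k)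
    calc β * (c * ‖v (x k)‖ ^ 2 / 2) ^ 2
        ≤ δ ^ h k * (-psi F (x k) (d k)) ^ 2 := by
          gcongr
          · exact hβle k
          · exact hψv k
      _ = ‖d k‖ ^ 2 * (α k * -psi F (x k) (d k)) := by
          rw [hα, sq (-psi F (x k) (d k))]
          nth_rewrite 1 [← hτd k]
          ring
      _ ≤ ξ₂ ^ 2 * (α k * -psi F (x k) (d k)) := by
          have := mul_pos (hαpos k) hψ
          gcongr
          exact hdb k
  have hCdec : ∀ k i, (1 - ηmax) * (ρ * α k * -psi F (x k) (d k)) ≤ C k i - C (k + 1) i :=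
    fun k i => by
      have hq := zero_lt_one.trans_le (hQ1 (k + 1))
      have h1 : ρ * α k * -psi F (x k) (d k) ≤ (C k i - C (k + 1) i) * Q (k + 1) := by
        rw [sub_mul, hCQ, hQ]
        linarith [hFstep k i]
      have h2 := mul_le_mul_of_nonneg_right (hQle (k + 1)) (hdec k).le
      refine le_of_mul_le_mul_right ?_ hq
      linarith
  let i₀ : Fin m := 0
  have hanti : Antitone fun k => C k i₀ := antitone_nat_of_succ_le fun k => by
    have := mul_pos (sub_pos.2 hηmax) (hdec k)
    linarith [hCdec k i₀]
  have hbelow : BddBelow (Set.range fun k => C k i₀) := by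
    obtain ⟨b, hb⟩ := hbdd i₀
    refine ⟨b, ?_⟩
    rintro _ ⟨k, rfl⟩
    exact (hb ⟨x k, rfl⟩).trans (hFC k i₀)
  have hlim := tendsto_atTop_ciInf hanti hbelow
  have hdiff0 : Filter.Tendsto (fun k => C k i₀ - C (k + 1) i₀) Filter.atTop (nhds 0) := by
    simpa using hlim.sub (hlim.comp (Filter.tendsto_add_atTop_nat 1))
  set A := (1 - ηmax) * ρ * (β * (c / 2) ^ 2) with hA
  have hA0 : 0 < A := by
    have := sub_pos.2 hηmax
    positivity
  have hv4 : ∀ k, ‖v (x k)‖ ^ 4 ≤ ξ₂ ^ 2 / A * (C k i₀ - C (k + 1) i₀) := fun k => by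
    rw [div_mul_eq_mul_div, le_div_iff₀ hA0]
    have h1 := mul_le_mul_of_nonneg_left (hbound k) (mul_pos (sub_pos.2 hηmax) hρ0).le
    have h2 := mul_le_mul_of_nonneg_left (hCdec k i₀) (sq_nonneg ξ₂)
    rw [hA]
    linarith
  have hv4lim : Filter.Tendsto (fun k => ‖v (x k)‖ ^ 4) Filter.atTop (nhds 0) :=
    squeeze_zero (fun k => by positivity) hv4 (by simpa using hdiff0.const_mul (ξ₂ ^ 2 / A))
  have hvlim : Filter.Tendsto (fun k => ‖v (x k)‖) Filter.atTop (nhds 0) := by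
    have h4 := hv4lim.sqrt.sqrt
    simp only [Real.sqrt_zero] at h4
    refine h4.congr fun k => ?_
    rw [show ‖v (x k)‖ ^ 4 = (‖v (x k)‖ ^ 2) ^ 2 by ring, Real.sqrt_sq (by positivity),
      Real.sqrt_sq (norm_nonneg _)]
  exact hvlim.liminf_eq
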